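/- arXiv:1303.7430 — 7 statements merged into one kernel-verified Lean document; each statement's English description precedes it below -/
import Mathlib

section
/- Let I and D be the minimal Herbrand models of Ξ(K) and dat(K), let q=∃y.ψ(x,y) be a conjunctive query, and let π* be a substitution with domain x∪y such that π*(q)⊆I. Then the substitution τ defined by τ(t)=δ(π*(t)) for each term t of q satisfies τ(q)⊆D; in particular, every certain answer to q over Ξ(K) is an answer to q over dat(K). -/
namespace ELHO

variable {C R V Ind : Type}

/-- Unary predicates: atomic concepts, ⊤ and ⊥. -/
inductive UPred (C : Type) where
  | conc : C → UPred C
  | top : UPred C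
  | bot : UPred C

/-- Concepts that are either atomic (`some A`) or ⊤ (`none`). -/
abbrev CT (C : Type) := Option C

/-- View a concept-or-⊤ as a unary predicate. -/
def ctU : CT C → UPred C
  | some A => .conc A
  | none => .top

def UPred.clist : UPred C → List C
  | .conc A => [A]
  | _ => []

/-- Normalised ELHO TBox axioms (Table 1). -/
inductive Ax (C R Ind : Type) where
  | nom : Ind → CT C → Ax C R Ind              -- {a} ⊑ A
  | sub : CT C → UPred C → Ax C R Ind          -- A ⊑ B
  | subNom : CT C → Ind → Ax C R Ind           -- A ⊑ {a}
  | conj : CT C → CT C → CT C → Ax C R Ind     -- A1 ⊓ A2 ⊑ A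
  | exSub : R → CT C → CT C → Ax C R Ind       -- ∃R.A1 ⊑ A
  | subEx : CT C → R → CT C → Ax C R Ind       -- A1 ⊑ ∃R.A
  | roleSub : R → R → Ax C R Ind               -- R ⊑ S
  | range : R → CT C → Ax C R Ind              -- ran(R) ⊑ A

/-- Atomic concepts occurring in an axiom. -/
def Ax.concepts : Ax C R Ind → List C
  | .nom _ A => A.toList
  | .sub A B => A.toList ++ B.clist
  | .subNom A _ => A.toList
  | .conj A1 A2 A => A1.toList ++ A2.toList ++ A.toList
  | .exSub _ A1 A => A1.toList ++ A.toList
  | .subEx A1 _ A => A1.toList ++ A.toList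
  | .roleSub _ _ => []
  | .range _ A => A.toList

/-- Roles occurring in an axiom. -/
def Ax.roles : Ax C R Ind → List R
  | .nom _ _ => []
  | .sub _ _ => []
  | .subNom _ _ => []
  | .conj _ _ _ => []
  | .exSub S _ _ => [S]
  | .subEx _ S _ => [S]
  | .roleSub S S' => [S, S']
  | .range S _ => [S]

/-- ABox assertions: ground facts over individuals. -/
inductive AFact (C R Ind : Type) where
  | unary : UPred C → Ind → AFact C R Ind
  | role : R → Ind → Ind → AFact C R Ind

/-- A normalised ELHO knowledge base K = ⟨T,A⟩. -/
structure KB (C R Ind : Type) where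
  tbox : List (Ax C R Ind)
  abox : List (AFact C R Ind)

/-- Terms of the Herbrand universe of Ξ(K): individuals and terms built with
    the unary function symbols `f_{R,A}`. -/
inductive XTerm (C R Ind : Type) where
  | ind : Ind → XTerm C R Ind
  | fn : R → CT C → XTerm C R Ind → XTerm C R Ind

/-- Terms of the Herbrand universe of dat(K): individuals and the auxiliary
    individuals `o_{R,A}`. -/
inductive DTerm (C R Ind : Type) where
  | ind : Ind → DTerm C R Ind
  | aux : R → CT C → DTerm C R Ind

/-- The mapping δ: δ(a) = a and δ(f_{R,A}(w')) = o_{R,A}. -/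
def δ : XTerm C R Ind → DTerm C R Ind
  | .ind a => .ind a
  | .fn S A _ => .aux S A

/-- Ground facts over a term type `T`. -/
inductive Fact (C R T : Type) where
  | unary : UPred C → T → Fact C R T
  | role : R → T → T → Fact C R T
  | eq : T → T → Fact C R T

/-- `t` occurs in the fact (any predicate, including ≈). -/
def occursF {T : Type} (t : T) : Fact C R T → Prop
  | .unary _ s => s = t
  | .role _ s s' => s = t ∨ s' = t
  | .eq s s' => s = t ∨ s' = t

/-- `t` occurs in the fact and the fact is not an ≈-fact. -/
def occursNE {T : Type} (t : T) : Fact C R T → Prop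
  | .unary _ s => s = t
  | .role _ s s' => s = t ∨ s' = t
  | .eq _ _ => False

/-- N_I(H): terms occurring in the model `H` in at least one non-≈ fact. -/
def NI {T : Type} (H : Fact C R T → Prop) (t : T) : Prop := ∃ f, H f ∧ occursNE t f

/-- `t` occurs in the model `H` (in any fact). -/
def occursM {T : Type} (H : Fact C R T → Prop) (t : T) : Prop := ∃ f, H f ∧ occursF t f

/-- aux(H): 'true' auxiliary terms of a Herbrand model `H`, i.e. the terms of
    N_I(H) that are ≈-equal to no named individual (`ι` injects the named
    individuals into the term type). -/
def auxT {T : Type} (H : Fact C R T → Prop) (ι : Ind → T) (t : T) : Prop :=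
  NI H t ∧ ∀ a : Ind, ¬ H (.eq t (ι a))

/-- The minimal Herbrand model of Ξ(K) (with the equality axiomatisation),
    defined as the least set of ground facts closed under all clauses of
    Ξ(K) ∪ Ξ(K)_≈. -/
inductive XI (K : KB C R Ind) : Fact C R (XTerm C R Ind) → Prop where
  | abU {B a} : AFact.unary B a ∈ K.abox → XI K (.unary B (.ind a))
  | abR {S a b} : AFact.role S a b ∈ K.abox → XI K (.role S (.ind a) (.ind b))
  | nom {a A} : Ax.nom a A ∈ K.tbox → XI K (.unary (ctU A) (.ind a))
  | sub {A B w} : Ax.sub A B ∈ K.tbox → XI K (.unary (ctU A) w) → XI K (.unary B w)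
  | subNom {A a w} : Ax.subNom A a ∈ K.tbox → XI K (.unary (ctU A) w) →
      XI K (.eq w (.ind a))
  | conj {A1 A2 A w} : Ax.conj A1 A2 A ∈ K.tbox → XI K (.unary (ctU A1) w) →
      XI K (.unary (ctU A2) w) → XI K (.unary (ctU A) w)
  | exSub {S A1 A w w'} : Ax.exSub S A1 A ∈ K.tbox → XI K (.role S w w') →
      XI K (.unary (ctU A1) w') → XI K (.unary (ctU A) w)
  | subEx1 {A1 S A w} : Ax.subEx A1 S A ∈ K.tbox → XI K (.unary (ctU A1) w) →
      XI K (.role S w (.fn S A w))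
  | subEx2 {A1 S A w} : Ax.subEx A1 S A ∈ K.tbox → XI K (.unary (ctU A1) w) →
      XI K (.unary (ctU A) (.fn S A w))
  | roleSub {S S' w w'} : Ax.roleSub S S' ∈ K.tbox → XI K (.role S w w') →
      XI K (.role S' w w')
  | range {S A w w'} : Ax.range S A ∈ K.tbox → XI K (.role S w w') →
      XI K (.unary (ctU A) w')
  | topU {A w} : A ∈ K.tbox.flatMap Ax.concepts → XI K (.unary (.conc A) w) →
      XI K (.unary .top w)
  | topR1 {S w w'} : S ∈ K.tbox.flatMap Ax.roles → XI K (.role S w w') →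
      XI K (.unary .top w)
  | topR2 {S w w'} : S ∈ K.tbox.flatMap Ax.roles → XI K (.role S w w') →
      XI K (.unary .top w')
  | refl {w f} : XI K f → occursF w f → XI K (.eq w w)
  | symm {w w'} : XI K (.eq w w') → XI K (.eq w' w)
  | trans {w1 w2 w3} : XI K (.eq w1 w2) → XI K (.eq w2 w3) → XI K (.eq w1 w3)
  | repU {B w w'} : XI K (.unary B w) → XI K (.eq w w') → XI K (.unary B w')
  | repR1 {S w1 w2 w'} : XI K (.role S w1 w2) → XI K (.eq w1 w') → XI K (.role S w' w2)
  | repR2 {S w1 w2 w'} : XI K (.role S w1 w2) → XI K (.eq w2 w') → XI K (.role S w1 w')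
  | repF {S A w w'} : XI K (.eq w w') → XI K (.eq (XTerm.fn S A w) (XTerm.fn S A w'))

/-- The minimal Herbrand model of dat(K) (with the equality axiomatisation). -/
inductive DM (K : KB C R Ind) : Fact C R (DTerm C R Ind) → Prop where
  | abU {B a} : AFact.unary B a ∈ K.abox → DM K (.unary B (.ind a))
  | abR {S a b} : AFact.role S a b ∈ K.abox → DM K (.role S (.ind a) (.ind b))
  | nom {a A} : Ax.nom a A ∈ K.tbox → DM K (.unary (ctU A) (.ind a))
  | sub {A B w} : Ax.sub A B ∈ K.tbox → DM K (.unary (ctU A) w) → DM K (.unary B w)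
  | subNom {A a w} : Ax.subNom A a ∈ K.tbox → DM K (.unary (ctU A) w) →
      DM K (.eq w (.ind a))
  | conj {A1 A2 A w} : Ax.conj A1 A2 A ∈ K.tbox → DM K (.unary (ctU A1) w) →
      DM K (.unary (ctU A2) w) → DM K (.unary (ctU A) w)
  | exSub {S A1 A w w'} : Ax.exSub S A1 A ∈ K.tbox → DM K (.role S w w') →
      DM K (.unary (ctU A1) w') → DM K (.unary (ctU A) w)
  | subEx1 {A1 S A w} : Ax.subEx A1 S A ∈ K.tbox → DM K (.unary (ctU A1) w) →
      DM K (.role S w (.aux S A))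
  | subEx2 {A1 S A w} : Ax.subEx A1 S A ∈ K.tbox → DM K (.unary (ctU A1) w) →
      DM K (.unary (ctU A) (.aux S A))
  | roleSub {S S' w w'} : Ax.roleSub S S' ∈ K.tbox → DM K (.role S w w') →
      DM K (.role S' w w')
  | range {S A w w'} : Ax.range S A ∈ K.tbox → DM K (.role S w w') →
      DM K (.unary (ctU A) w')
  | topU {A w} : A ∈ K.tbox.flatMap Ax.concepts → DM K (.unary (.conc A) w) →
      DM K (.unary .top w)
  | topR1 {S w w'} : S ∈ K.tbox.flatMap Ax.roles → DM K (.role S w w') →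
      DM K (.unary .top w)
  | topR2 {S w w'} : S ∈ K.tbox.flatMap Ax.roles → DM K (.role S w w') →
      DM K (.unary .top w')
  | refl {w f} : DM K f → occursF w f → DM K (.eq w w)
  | symm {w w'} : DM K (.eq w w') → DM K (.eq w' w)
  | trans {w1 w2 w3} : DM K (.eq w1 w2) → DM K (.eq w2 w3) → DM K (.eq w1 w3)
  | repU {B w w'} : DM K (.unary B w) → DM K (.eq w w') → DM K (.unary B w')
  | repR1 {S w1 w2 w'} : DM K (.role S w1 w2) → DM K (.eq w1 w') → DM K (.role S w' w2)
  | repR2 {S w1 w2 w'} : DM K (.role S w1 w2) → DM K (.eq w2 w') → DM K (.role S w1 w')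

/-- Terms of a conjunctive query: variables and individuals (constants). -/
inductive QTerm (V Ind : Type) where
  | var : V → QTerm V Ind
  | const : Ind → QTerm V Ind

/-- Function-free atoms of a conjunctive query. -/
inductive QAtom (C R V Ind : Type) where
  | unary : UPred C → QTerm V Ind → QAtom C R V Ind
  | role : R → QTerm V Ind → QTerm V Ind → QAtom C R V Ind

/-- A conjunctive query q = ∃y.ψ(x,y): a set of atoms together with the
    predicate selecting the answer variables x. -/
structure CQ (C R V Ind : Type) where
  answers : V → Prop
  atoms : List (QAtom C R V Ind)

/-- Extension of a substitution on variables to query terms. -/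
def QTerm.evalT {T : Type} (ι : Ind → T) (σ : V → T) : QTerm V Ind → T
  | .var v => σ v
  | .const a => ι a

/-- Application of a substitution to a query atom. -/
def QAtom.applyA {T : Type} (ι : Ind → T) (σ : V → T) : QAtom C R V Ind → Fact C R T
  | .unary B t => .unary B (t.evalT ι σ)
  | .role S s t => .role S (s.evalT ι σ) (t.evalT ι σ)

/-- terms(q). -/
def CQ.terms (q : CQ C R V Ind) : List (QTerm V Ind) :=
  q.atoms.flatMap fun a => match a with
    | .unary _ t => [t]
    | .role _ s t => [s, t]

/-- Ξ(K) ⊨ σ(q): every atom of q is mapped by σ into the minimal Herbrand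
    model of Ξ(K). -/
def holdsX (K : KB C R Ind) (q : CQ C R V Ind) (σ : V → XTerm C R Ind) : Prop :=
  ∀ a ∈ q.atoms, XI K (a.applyA XTerm.ind σ)

/-- dat(K) ⊨ τ(q). -/
def holdsD (K : KB C R Ind) (q : CQ C R V Ind) (τ : V → DTerm C R Ind) : Prop :=
  ∀ a ∈ q.atoms, DM K (a.applyA DTerm.ind τ)

/-- aux(dat(K)): the individuals u of dat(K) such that dat(K) ⊨ u ≈ c for no
    named individual c. -/
def auxDat (K : KB C R Ind) (u : DTerm C R Ind) : Prop :=
  ∀ a : Ind, ¬ DM K (.eq u (.ind a))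

/-- Extension of τ to the query terms (over dat(K)-terms). -/
def evalD (τ : V → DTerm C R Ind) : QTerm V Ind → DTerm C R Ind :=
  QTerm.evalT DTerm.ind τ

/-- Extension of π* to the query terms (over Ξ(K)-terms). -/
def evalX (σ : V → XTerm C R Ind) : QTerm V Ind → XTerm C R Ind :=
  QTerm.evalT XTerm.ind σ

/-- The relation ∼ on terms(q) for q, τ and dat(K): the smallest reflexive,
    symmetric and transitive relation closed under the fork rule. -/
inductive Sim (K : KB C R Ind) (q : CQ C R V Ind) (τ : V → DTerm C R Ind) :
    QTerm V Ind → QTerm V Ind → Prop where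
  | refl {t} : t ∈ q.terms → Sim K q τ t t
  | symm {s t} : Sim K q τ s t → Sim K q τ t s
  | trans {s t u} : Sim K q τ s t → Sim K q τ t u → Sim K q τ s u
  | fork {s s' t t' Rr P} : Sim K q τ s' t' → QAtom.role Rr s s' ∈ q.atoms →
      QAtom.role P t t' ∈ q.atoms → auxDat K (evalD τ s') → Sim K q τ s t

/-- The ∼-class of `t` is a vertex of G_aux, i.e. it contains a term mapped by
    τ to a 'true' auxiliary individual. -/
def isAuxVertex (K : KB C R Ind) (q : CQ C R V Ind) (τ : V → DTerm C R Ind)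
    (t : QTerm V Ind) : Prop :=
  ∃ t' ∈ q.terms, Sim K q τ t t' ∧ auxDat K (evalD τ t')

/-- The edge relation of G_aux, expressed on representatives modulo ∼:
    an edge from the class of u to the class of v for each atom R(s,t) of q
    with u ∼ s, v ∼ t and both classes vertices of G_aux. -/
def auxEdge (K : KB C R Ind) (q : CQ C R V Ind) (τ : V → DTerm C R Ind)
    (u v : QTerm V Ind) : Prop :=
  ∃ (S : R) (s t : QTerm V Ind), QAtom.role S s t ∈ q.atoms ∧
    Sim K q τ u s ∧ Sim K q τ v t ∧ isAuxVertex K q τ s ∧ isAuxVertex K q τ t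

/-- q is aux-cyclic w.r.t. τ and dat(K): G_aux contains a cycle. -/
def auxCyclic (K : KB C R Ind) (q : CQ C R V Ind) (τ : V → DTerm C R Ind) : Prop :=
  ∃ t, Relation.TransGen (auxEdge K q τ) t t

/-- isSpurious(q, dat(K), τ) = true. -/
def Spurious (K : KB C R Ind) (q : CQ C R V Ind) (τ : V → DTerm C R Ind) : Prop :=
  (∃ v, q.answers v ∧ ∀ a : Ind, τ v ≠ .ind a) ∨
  (∃ s t, Sim K q τ s t ∧ ¬ DM K (.eq (evalD τ s) (evalD τ t))) ∨
  auxCyclic K q τ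

open Classical in
/-- depth(w, I): 0 for terms outside aux(I), and 1 + depth of the argument for
    functional terms in aux(I). -/
noncomputable def depth (K : KB C R Ind) : XTerm C R Ind → ℕ
  | .ind _ => 0
  | .fn S A w => if auxT (XI K) XTerm.ind (.fn S A w) then 1 + depth K w else 0


/-- The `δ`-image of a fact holds in the minimal Herbrand model of dat(K), where an equality may
also hold because `δ` identifies its two sides: congruence for the function symbols gives
equalities between terms whose images need not occur in dat(K). -/
def HoldsUnderδ (K : KB C R Ind) : Fact C R (XTerm C R Ind) → Prop
  | .unary B w => DM K (.unary B (δ w))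
  | .role S w w' => DM K (.role S (δ w) (δ w'))
  | .eq w w' => DM K (.eq (δ w) (δ w')) ∨ δ w = δ w'

theorem XI.holdsUnderδ {K : KB C R Ind} {f : Fact C R (XTerm C R Ind)} (h : XI K f) :
    HoldsUnderδ K f := by
  induction h with
  | abU h => exact DM.abU h
  | abR h => exact DM.abR h
  | nom h => exact DM.nom h
  | sub h _ ih => exact DM.sub h ih
  | subNom h _ ih => exact .inl (DM.subNom h ih)
  | conj h _ _ ih₁ ih₂ => exact DM.conj h ih₁ ih₂
  | exSub h _ _ ih₁ ih₂ => exact DM.exSub h ih₁ ih₂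
  | subEx1 h _ ih => exact DM.subEx1 h ih
  | subEx2 h _ ih => exact DM.subEx2 h ih
  | roleSub h _ ih => exact DM.roleSub h ih
  | range h _ ih => exact DM.range h ih
  | topU h _ ih => exact DM.topU h ih
  | topR1 h _ ih => exact DM.topR1 h ih
  | topR2 h _ ih => exact DM.topR2 h ih
  | refl _ _ _ => exact .inr rfl
  | symm _ ih => exact ih.imp DM.symm Eq.symm
  | trans _ _ ih₁ ih₂ =>
    rcases ih₁ with h₁ | h₁
    · exact ih₂.elim (fun h₂ => .inl (h₁.trans h₂)) (fun h₂ => .inl (h₂ ▸ h₁))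
    · simpa only [HoldsUnderδ, h₁] using ih₂
  | repU _ _ ih₁ ih₂ =>
    exact ih₂.elim (DM.repU ih₁) (fun e => by simpa only [HoldsUnderδ, e] using ih₁)
  | repR1 _ _ ih₁ ih₂ =>
    exact ih₂.elim (DM.repR1 ih₁) (fun e => by simpa only [HoldsUnderδ, e] using ih₁)
  | repR2 _ _ ih₁ ih₂ =>
    exact ih₂.elim (DM.repR2 ih₁) (fun e => by simpa only [HoldsUnderδ, e] using ih₁)
  | repF _ _ => exact .inr rfl

theorem δ_evalT (σ : V → XTerm C R Ind) (t : QTerm V Ind) :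
    δ (t.evalT XTerm.ind σ) = t.evalT DTerm.ind (fun v => δ (σ v)) := by
  cases t <;> rfl

theorem holdsX.holdsD_δ {K : KB C R Ind} {q : CQ C R V Ind} {σ : V → XTerm C R Ind}
    (h : holdsX K q σ) : holdsD K q (fun v => δ (σ v)) := by
  intro a ha
  have h' := (h a ha).holdsUnderδ
  cases a <;> simpa only [QAtom.applyA, HoldsUnderδ, δ_evalT] using h'

/-- Homomorphisms preserve CQ answers: if π* maps q into the minimal Herbrand
    model of Ξ(K), then τ = δ ∘ π* maps q into the minimal Herbrand model of
    dat(K); in particular, every certain answer to q over Ξ(K) is an answer to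
    q over dat(K). -/
theorem certain_answers_preserved (K : KB C R Ind) (q : CQ C R V Ind)
    (πs : V → XTerm C R Ind) (h : holdsX K q πs) :
    holdsD K q (fun v => δ (πs v))
  ∧ ∀ π : V → Ind,
      (∃ σ : V → XTerm C R Ind,
          (∀ v, q.answers v → σ v = .ind (π v)) ∧ holdsX K q σ) →
      (∃ τ : V → DTerm C R Ind,
          (∀ v, q.answers v → τ v = .ind (π v)) ∧ holdsD K q τ) := by
  refine ⟨h.holdsD_δ, ?_⟩
  rintro π ⟨σ, hσ, hq⟩
  exact ⟨fun v => δ (σ v), fun v hv => by simp only [hσ v hv, δ], hq.holdsD_δ⟩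

end ELHO
end

section
/- Let I and D be the minimal Herbrand models of Ξ(K) and dat(K), respectively. For all terms w1, w2 ∈ N_I(I), each B among the atomic concepts, ⊤ and ⊥, and each role R: (1) B(δ(w1))∈D implies B(w1)∈I; (2) R(δ(w1),δ(w2))∈D and δ(w2)∉aux(D) imply R(w1,w2)∈I; (3) R(δ(w1),δ(w2))∈D and δ(w2)∈aux(D) imply that δ(w2) is of the form o_{P,A}, that R(w1,f_{P,A}(w1))∈I, and that some term w1' exists with R(w1',w2)∈I; (4) δ(w1)≈δ(w2)∈D and δ(w2)∉aux(D) imply w1≈w2∈I; (5) for each term u occurring in D there exists w∈N_I(I) with δ(w)=u. -/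
namespace ELHO

variable {C R V Ind : Type}

/-- `fn S A w` is generated if some axiom `A1 ⊑ ∃S.A` applies to `w` in the minimal model of Ξ(K);
every individual is generated. -/
def Generated (K : KB C R Ind) : XTerm C R Ind → Prop
  | .ind _ => True
  | .fn S A w => ∃ A1, Ax.subEx A1 S A ∈ K.tbox ∧ XI K (.unary (ctU A1) w)

/-- The terms of a non-≈ fact are generated; an ≈-fact relates terms that are both generated or
both not generated. -/
def GeneratedFact (K : KB C R Ind) : Fact C R (XTerm C R Ind) → Prop
  | .unary _ w => Generated K w
  | .role _ w w' => Generated K w ∧ Generated K w'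
  | .eq w w' => Generated K w ↔ Generated K w'

theorem XI.generatedFact {K : KB C R Ind} {f} (h : XI K f) : GeneratedFact K f := by
  induction h with
  | subEx1 hx hu ih => exact ⟨ih, _, hx, hu⟩
  | subEx2 hx hu ih => exact ⟨_, hx, hu⟩
  | subNom _ _ ih => exact ⟨fun _ => trivial, fun _ => ih⟩
  | repF h ih =>
    exact ⟨fun ⟨A1, hx, hu⟩ => ⟨A1, hx, hu.repU h⟩, fun ⟨A1, hx, hu⟩ => ⟨A1, hx, hu.repU h.symm⟩⟩
  | _ => simp_all [GeneratedFact, Generated]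

theorem NI.generated {K : KB C R Ind} {w} (h : NI (XI K) w) : Generated K w := by
  obtain ⟨f, hf, ho⟩ := h
  have hg := hf.generatedFact
  cases f <;> simp only [occursNE, GeneratedFact] at ho hg
  · exact ho ▸ hg
  · rcases ho with rfl | rfl
    exacts [hg.1, hg.2]

section NI

variable {T : Type} {H : Fact C R T → Prop}

theorem NI.of_unary {B : UPred C} {w : T} (h : H (.unary B w)) : NI H w := ⟨_, h, rfl⟩

theorem NI.of_role_left {S : R} {w w' : T} (h : H (.role S w w')) : NI H w := ⟨_, h, .inl rfl⟩

theorem NI.of_role_right {S : R} {w w' : T} (h : H (.role S w w')) : NI H w' := ⟨_, h, .inr rfl⟩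

end NI

theorem NI.eq_refl {K : KB C R Ind} {w} (h : NI (XI K) w) : XI K (.eq w w) := by
  obtain ⟨f, hf, ho⟩ := h
  refine hf.refl (f := f) ?_
  cases f
  exacts [ho, ho, ho.elim]

/-- `w` is a term of N_I of the minimal model of Ξ(K) lying over `u`. -/
def Over (K : KB C R Ind) (u : DTerm C R Ind) (w : XTerm C R Ind) : Prop :=
  NI (XI K) w ∧ δ w = u

/-- In both models, `u` respectively all terms over `u` are equal to the named individual `a`. -/
def NamedBy (K : KB C R Ind) (u : DTerm C R Ind) (a : Ind) : Prop :=
  DM K (.eq u (.ind a)) ∧ ∀ w, Over K u w → XI K (.eq w (.ind a))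

theorem Over.eq_ind {K : KB C R Ind} {a : Ind} {w} (h : Over K (.ind a) w) : w = .ind a := by
  obtain ⟨-, h⟩ := h
  cases w <;> simp_all [δ]

theorem Over.exists_eq_fn {K : KB C R Ind} {S A w} (h : Over K (.aux S A) w) :
    ∃ w0, w = .fn S A w0 := by
  obtain ⟨-, h⟩ := h
  cases w <;> simp_all [δ]

theorem Over.fn_of_role {K : KB C R Ind} {S P A w w'} (h : XI K (.role S w (.fn P A w'))) :
    Over K (.aux P A) (.fn P A w') := ⟨.of_role_right h, rfl⟩

theorem namedBy_ind {K : KB C R Ind} {a : Ind} (h : DM K (.eq (.ind a) (.ind a))) :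
    NamedBy K (.ind a) a :=
  ⟨h, fun w hw => by obtain rfl := hw.eq_ind; exact hw.1.eq_refl⟩

/-- How a role fact over `dat(K)` is reflected in the minimal model of Ξ(K). -/
def RoleTransfer (K : KB C R Ind) (S : R) (u v : DTerm C R Ind) : Prop :=
  ((∃ a, NamedBy K v a) ∧ ∀ w w', Over K u w → Over K v w' → XI K (.role S w w')) ∨
  ∃ P A, v = .aux P A ∧ (∀ w, Over K u w → XI K (.role S w (.fn P A w))) ∧
    ∀ w', Over K v w' → ∃ w, XI K (.role S w w')

/-- How a fact over `dat(K)` is reflected in the minimal model of Ξ(K). -/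
def Transfer (K : KB C R Ind) : Fact C R (DTerm C R Ind) → Prop
  | .unary B u => (∃ w, Over K u w) ∧ ∀ w, Over K u w → XI K (.unary B w)
  | .role S u v => (∃ w, Over K u w) ∧ (∃ w, Over K v w) ∧ RoleTransfer K S u v
  | .eq u v => (∃ w, Over K u w) ∧ (∃ w, Over K v w) ∧
      (u = v ∨ ∃ a, NamedBy K u a ∧ NamedBy K v a)

theorem Transfer.exists_over {K : KB C R Ind} {f u} (h : Transfer K f) (ho : occursF u f) :
    ∃ w, Over K u w := by
  cases f <;> simp only [occursF, Transfer] at ho h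
  · exact ho ▸ h.1
  · rcases ho with rfl | rfl
    exacts [h.1, h.2.1]
  · rcases ho with rfl | rfl
    exacts [h.1, h.2.1]

/-- Every term over the first argument of a transferred role fact has a successor over the second
argument. -/
theorem RoleTransfer.exists_right {K : KB C R Ind} {S u v w} (h : RoleTransfer K S u v)
    (hv : ∃ w', Over K v w') (hw : Over K u w) : ∃ w', Over K v w' ∧ XI K (.role S w w') := by
  rcases h with ⟨-, h⟩ | ⟨P, A, rfl, h, -⟩
  · obtain ⟨w', hw'⟩ := hv
    exact ⟨w', hw', h _ _ hw hw'⟩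
  · exact ⟨_, .fn_of_role (h _ hw), h _ hw⟩

/-- Every term over the second argument of a transferred role fact has a predecessor. -/
theorem RoleTransfer.exists_left {K : KB C R Ind} {S u v w'} (h : RoleTransfer K S u v)
    (hu : ∃ w, Over K u w) (hw' : Over K v w') : ∃ w, XI K (.role S w w') := by
  rcases h with ⟨-, h⟩ | ⟨P, A, -, -, h⟩
  · obtain ⟨w, hw⟩ := hu
    exact ⟨w, h _ _ hw hw'⟩
  · exact h _ hw'

theorem RoleTransfer.role_of_namedBy {K : KB C R Ind} {S u v w w' a} (h : RoleTransfer K S u v)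
    (ha : NamedBy K v a) (hw : Over K u w) (hw' : Over K v w') : XI K (.role S w w') := by
  obtain ⟨x, hx, hr⟩ := h.exists_right ⟨w', hw'⟩ hw
  exact hr.repR2 ((ha.2 _ hx).trans (ha.2 _ hw').symm)

theorem RoleTransfer.mono {K : KB C R Ind} {S S' u v}
    (hS : ∀ w w', XI K (.role S w w') → XI K (.role S' w w')) (h : RoleTransfer K S u v) :
    RoleTransfer K S' u v := by
  rcases h with ⟨ha, h⟩ | ⟨P, A, hv, h, h'⟩
  · exact .inl ⟨ha, fun _ _ hw hw' => hS _ _ (h _ _ hw hw')⟩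
  · exact .inr ⟨P, A, hv, fun _ hw => hS _ _ (h _ hw),
      fun _ hw' => (h' _ hw').imp fun _ => hS _ _⟩

theorem RoleTransfer.congr_left {K : KB C R Ind} {S u u' v a} (h : RoleTransfer K S u v)
    (hu : ∃ w, Over K u w) (ha : NamedBy K u a) (ha' : NamedBy K u' a) :
    RoleTransfer K S u' v := by
  obtain ⟨x, hx⟩ := hu
  have key : ∀ w, Over K u' w → XI K (.eq x w) := fun w hw => (ha.2 _ hx).trans (ha'.2 _ hw).symm
  rcases h with ⟨hv, h⟩ | ⟨P, A, hv, h, h'⟩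
  · exact .inl ⟨hv, fun w w' hw hw' => (h _ _ hx hw').repR1 (key w hw)⟩
  · exact .inr ⟨P, A, hv, fun w hw => ((h _ hx).repR1 (key w hw)).repR2 (key w hw).repF, h'⟩

theorem NamedBy.of_over {K : KB C R Ind} {u v w a b} (hw : Over K v w) (hu : NamedBy K u a)
    (hva : NamedBy K v a) (hvb : NamedBy K v b) : NamedBy K u b :=
  ⟨hu.1.trans (hva.1.symm.trans hvb.1),
    fun _ hx => (hu.2 _ hx).trans ((hva.2 _ hw).symm.trans (hvb.2 _ hw))⟩

theorem DM.transfer {K : KB C R Ind} {f} (h : DM K f) : Transfer K f := by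
  induction h with
  | abU h =>
    exact ⟨⟨_, .of_unary (.abU h), rfl⟩, fun _ hw => hw.eq_ind ▸ .abU h⟩
  | abR h =>
    refine ⟨⟨_, .of_role_left (.abR h), rfl⟩, ⟨_, .of_role_right (.abR h), rfl⟩, .inl
      ⟨⟨_, namedBy_ind ((DM.abR h).refl (.inr rfl))⟩, fun _ _ hw hw' => ?_⟩⟩
    rw [hw.eq_ind, hw'.eq_ind]
    exact .abR h
  | nom h =>
    exact ⟨⟨_, .of_unary (.nom h), rfl⟩, fun _ hw => hw.eq_ind ▸ .nom h⟩
  | sub h _ ih => exact ⟨ih.1, fun _ hw => .sub h (ih.2 _ hw)⟩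
  | subNom h hu ih =>
    obtain ⟨⟨w, hw⟩, ih⟩ := ih
    have he := DM.subNom h hu
    exact ⟨⟨w, hw⟩, ⟨_, .of_unary ((ih _ hw).repU (.subNom h (ih _ hw))), rfl⟩, .inr
      ⟨_, ⟨he, fun x hx => .subNom h (ih _ hx)⟩, namedBy_ind (he.refl (.inr rfl))⟩⟩
  | conj h _ _ ih1 ih2 => exact ⟨ih1.1, fun _ hw => .conj h (ih1.2 _ hw) (ih2.2 _ hw)⟩
  | exSub h _ _ ih1 ih2 =>
    refine ⟨ih1.1, fun w hw => ?_⟩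
    obtain ⟨w', hw', hr⟩ := ih1.2.2.exists_right ih1.2.1 hw
    exact .exSub h hr (ih2.2 _ hw')
  | subEx1 h _ ih =>
    obtain ⟨⟨w, hw⟩, ih⟩ := ih
    refine ⟨⟨w, hw⟩, ⟨_, .fn_of_role (.subEx1 h (ih _ hw))⟩, .inr
      ⟨_, _, rfl, fun w hw => .subEx1 h (ih _ hw), fun w' hw' => ?_⟩⟩
    obtain ⟨w0, rfl⟩ := hw'.exists_eq_fn
    obtain ⟨A1, hx, hu⟩ := hw'.1.generated
    exact ⟨w0, .subEx1 hx hu⟩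
  | subEx2 h _ ih =>
    obtain ⟨⟨w, hw⟩, ih⟩ := ih
    refine ⟨⟨_, .fn_of_role (.subEx1 h (ih _ hw))⟩, fun w' hw' => ?_⟩
    obtain ⟨w0, rfl⟩ := hw'.exists_eq_fn
    obtain ⟨A1, hx, hu⟩ := hw'.1.generated
    exact .subEx2 hx hu
  | roleSub h _ ih => exact ⟨ih.1, ih.2.1, ih.2.2.mono fun _ _ => .roleSub h⟩
  | range h _ ih =>
    exact ⟨ih.2.1, fun _ hw => (ih.2.2.exists_left ih.1 hw).elim fun _ hr => .range h hr⟩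
  | topU h _ ih => exact ⟨ih.1, fun _ hw => .topU h (ih.2 _ hw)⟩
  | topR1 h _ ih =>
    exact ⟨ih.1, fun _ hw => (ih.2.2.exists_right ih.2.1 hw).elim fun _ hr => .topR1 h hr.2⟩
  | topR2 h _ ih =>
    exact ⟨ih.2.1, fun _ hw => (ih.2.2.exists_left ih.1 hw).elim fun _ hr => .topR2 h hr⟩
  | refl _ ho ih => exact ⟨ih.exists_over ho, ih.exists_over ho, .inl rfl⟩
  | symm _ ih => exact ⟨ih.2.1, ih.1, ih.2.2.imp Eq.symm fun ⟨a, h, h'⟩ => ⟨a, h', h⟩⟩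
  | trans _ _ ih1 ih2 =>
    refine ⟨ih1.1, ih2.2.1, ?_⟩
    rcases ih1.2.2 with rfl | ⟨a, hu, hva⟩
    · exact ih2.2.2
    · rcases ih2.2.2 with rfl | ⟨b, hvb, hx⟩
      · exact .inr ⟨a, hu, hva⟩
      · obtain ⟨w, hw⟩ := ih1.2.1
        exact .inr ⟨b, .of_over hw hu hva hvb, hx⟩
  | repU _ _ ih1 ih2 =>
    refine ⟨ih2.2.1, fun w hw => ?_⟩
    rcases ih2.2.2 with rfl | ⟨a, hu, hv⟩
    · exact ih1.2 _ hw
    · obtain ⟨x, hx⟩ := ih1.1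
      exact (ih1.2 _ hx).repU ((hu.2 _ hx).trans (hv.2 _ hw).symm)
  | repR1 _ _ ih1 ih2 =>
    refine ⟨ih2.2.1, ih1.2.1, ?_⟩
    rcases ih2.2.2 with rfl | ⟨a, hu, hu'⟩
    exacts [ih1.2.2, ih1.2.2.congr_left ih1.1 hu hu']
  | repR2 _ _ ih1 ih2 =>
    refine ⟨ih1.1, ih2.2.1, ?_⟩
    rcases ih2.2.2 with rfl | ⟨a, hv, hv'⟩
    · exact ih1.2.2
    · obtain ⟨x, hx⟩ := ih1.2.1
      exact .inl ⟨⟨a, hv'⟩, fun w w' hw hw' => (ih1.2.2.role_of_namedBy hv hw hx).repR2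
        ((hv.2 _ hx).trans (hv'.2 _ hw').symm)⟩

theorem DM.ni_of_occursF {K : KB C R Ind} {f u} (h : DM K f) (ho : occursF u f) :
    NI (DM K) u := by
  have aux : ∀ {f}, DM K f → ∀ {u v}, f = .eq u v → NI (DM K) u ∧ NI (DM K) v := by
    intro f h
    induction h with
    | subNom hx hu =>
      rintro _ _ ⟨⟩
      exact ⟨.of_unary hu, .of_unary (hu.repU (.subNom hx hu))⟩
    | @refl w f hf ho ih =>
      rintro _ _ ⟨⟩
      rw [and_self]
      cases f with
      | unary => exact ⟨_, hf, ho⟩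
      | role => exact ⟨_, hf, ho⟩
      | eq => rcases ho with rfl | rfl; exacts [(ih rfl).1, (ih rfl).2]
    | symm _ ih =>
      rintro _ _ ⟨⟩
      exact (ih rfl).symm
    | trans _ _ ih1 ih2 =>
      rintro _ _ ⟨⟩
      exact ⟨(ih1 rfl).1, (ih2 rfl).2⟩
    | _ => rintro _ _ ⟨⟩
  cases f with
  | unary => exact ⟨_, h, ho⟩
  | role => exact ⟨_, h, ho⟩
  | eq => rcases ho with rfl | rfl; exacts [(aux h rfl).1, (aux h rfl).2]

theorem exists_namedBy_of_not_auxT {K : KB C R Ind} {f u} (h : DM K f) (ho : occursF u f)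
    (ha : ¬ auxT (DM K) DTerm.ind u) : ∃ a, NamedBy K u a := by
  obtain ⟨a, he⟩ : ∃ a : Ind, DM K (.eq u (.ind a)) := by
    by_contra! hne
    exact ha ⟨h.ni_of_occursF ho, hne⟩
  rcases he.transfer.2.2 with rfl | ⟨b, hb, -⟩
  exacts [⟨a, namedBy_ind he⟩, ⟨b, hb⟩]

/-- The five backwards-transfer properties of δ between the minimal Herbrand
    models I of Ξ(K) and D of dat(K). -/
theorem dat_embed (K : KB C R Ind) :
    (∀ w1 : XTerm C R Ind, NI (XI K) w1 →
        ∀ B : UPred C, DM K (.unary B (δ w1)) → XI K (.unary B w1))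
  ∧ (∀ w1 w2 : XTerm C R Ind, NI (XI K) w1 → NI (XI K) w2 → ∀ S : R,
        DM K (.role S (δ w1) (δ w2)) → ¬ auxT (DM K) DTerm.ind (δ w2) →
        XI K (.role S w1 w2))
  ∧ (∀ w1 w2 : XTerm C R Ind, NI (XI K) w1 → NI (XI K) w2 → ∀ S : R,
        DM K (.role S (δ w1) (δ w2)) → auxT (DM K) DTerm.ind (δ w2) →
        ∃ (P : R) (A : CT C), δ w2 = DTerm.aux P A ∧
          XI K (.role S w1 (.fn P A w1)) ∧ ∃ w1', XI K (.role S w1' w2))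
  ∧ (∀ w1 w2 : XTerm C R Ind, NI (XI K) w1 → NI (XI K) w2 →
        DM K (.eq (δ w1) (δ w2)) → ¬ auxT (DM K) DTerm.ind (δ w2) →
        XI K (.eq w1 w2))
  ∧ (∀ u : DTerm C R Ind, occursM (DM K) u →
        ∃ w : XTerm C R Ind, NI (XI K) w ∧ δ w = u) := by
  refine ⟨fun w hw B h => h.transfer.2 _ ⟨hw, rfl⟩, fun w1 w2 hw1 hw2 S h ha => ?_,
    fun w1 w2 hw1 hw2 S h ha => ?_, fun w1 w2 hw1 hw2 h ha => ?_,
    fun u ⟨f, hf, ho⟩ => hf.transfer.exists_over ho⟩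
  · obtain ⟨a, hn⟩ := exists_namedBy_of_not_auxT h (.inr rfl) ha
    exact h.transfer.2.2.role_of_namedBy hn ⟨hw1, rfl⟩ ⟨hw2, rfl⟩
  · rcases h.transfer.2.2 with ⟨⟨a, hn⟩, -⟩ | ⟨P, A, hv, hr, hl⟩
    · exact absurd hn.1 (ha.2 a)
    · exact ⟨P, A, hv, hr _ ⟨hw1, rfl⟩, hl _ ⟨hw2, rfl⟩⟩
  · obtain ⟨a, h1, h2⟩ : ∃ a, NamedBy K (δ w1) a ∧ NamedBy K (δ w2) a := by
      rcases h.transfer.2.2 with he | hn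
      · obtain ⟨a, hn⟩ := exists_namedBy_of_not_auxT h (.inr rfl) ha
        exact ⟨a, he ▸ hn, hn⟩
      · exact hn
    exact (h1.2 _ ⟨hw1, rfl⟩).trans (h2.2 _ ⟨hw2, rfl⟩).symm

end ELHO
end

section
/- For every normalised ELHO knowledge base K: the minimal Herbrand model of Ξ(K) contains a fact ⊥(w) for some term w if and only if the minimal Herbrand model of dat(K) contains a fact ⊥(u) for some term u; that is, Ξ(K)⊨∃y.⊥(y) iff dat(K)⊨∃y.⊥(y), so the satisfiability of K can be decided on the datalog program dat(K). -/
namespace ELHO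

variable {C R V Ind : Type}

/-- The image under `δ` of a fact of Ξ(K) holds in dat(K), where an equality may also collapse to
a syntactic identity. -/
def DeltaHolds (K : KB C R Ind) : Fact C R (XTerm C R Ind) → Prop
  | .unary B w => DM K (.unary B (δ w))
  | .role S w w' => DM K (.role S (δ w) (δ w'))
  | .eq w w' => δ w = δ w' ∨ DM K (.eq (δ w) (δ w'))

theorem XI.deltaHolds {K : KB C R Ind} {f : Fact C R (XTerm C R Ind)} (h : XI K f) :
    DeltaHolds K f := by
  induction h with
  | abU h => exact .abU h
  | abR h => exact .abR h
  | nom h => exact .nom h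
  | sub h _ ih => exact .sub h ih
  | subNom h _ ih => exact .inr (.subNom h ih)
  | conj h _ _ ih1 ih2 => exact .conj h ih1 ih2
  | exSub h _ _ ih1 ih2 => exact .exSub h ih1 ih2
  | subEx1 h _ ih => exact .subEx1 h ih
  | subEx2 h _ ih => exact .subEx2 h ih
  | roleSub h _ ih => exact .roleSub h ih
  | range h _ ih => exact .range h ih
  | topU h _ ih => exact .topU h ih
  | topR1 h _ ih => exact .topR1 h ih
  | topR2 h _ ih => exact .topR2 h ih
  | refl _ _ _ => exact .inl rfl
  | symm _ ih => exact ih.imp Eq.symm DM.symm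
  | trans _ _ ih1 ih2 =>
    rcases ih1 with e1 | h1
    · simpa only [DeltaHolds, e1] using ih2
    · rcases ih2 with e2 | h2
      · exact .inr (e2 ▸ h1)
      · exact .inr (h1.trans h2)
  | repU _ _ ih1 ih2 =>
    rcases ih2 with e | h
    · simpa only [DeltaHolds, e] using ih1
    · exact .repU ih1 h
  | repR1 _ _ ih1 ih2 =>
    rcases ih2 with e | h
    · simpa only [DeltaHolds, e] using ih1
    · exact .repR1 ih1 h
  | repR2 _ _ ih1 ih2 =>
    rcases ih2 with e | h
    · simpa only [DeltaHolds, e] using ih1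
    · exact .repR2 ih1 h
  | repF _ _ => exact .inl rfl

/-- `Lifts K u w`: the term `w` of Ξ(K) lies over the term `u` of dat(K) and, if functional, is
generated by an existential axiom in the minimal model of Ξ(K). -/
inductive Lifts (K : KB C R Ind) : DTerm C R Ind → XTerm C R Ind → Prop where
  | ind (a : Ind) : Lifts K (.ind a) (.ind a)
  | aux {A1 S A w} : Ax.subEx A1 S A ∈ K.tbox → XI K (.unary (ctU A1) w) →
      Lifts K (.aux S A) (.fn S A w)

/-- All terms of the fact of dat(K) have lifts, and the fact is reflected on lifts in Ξ(K). -/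
def LiftHolds (K : KB C R Ind) : Fact C R (DTerm C R Ind) → Prop
  | .unary B u => (∃ w, Lifts K u w) ∧ ∀ w, Lifts K u w → XI K (.unary B w)
  | .role S u v => (∃ w, Lifts K u w) ∧ (∃ w', Lifts K v w') ∧
      (∀ w, Lifts K u w → ∃ w', Lifts K v w' ∧ XI K (.role S w w')) ∧
      ∀ w', Lifts K v w' → ∃ w, XI K (.role S w w')
  | .eq u v => (∃ w, Lifts K u w) ∧ (∃ w', Lifts K v w') ∧
      (u = v ∨ ∀ w w', Lifts K u w → Lifts K v w' → XI K (.eq w w'))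

theorem LiftHolds.exists_lifts {K : KB C R Ind} {f : Fact C R (DTerm C R Ind)}
    (h : LiftHolds K f) {u : DTerm C R Ind} (hu : occursF u f) : ∃ w, Lifts K u w := by
  cases f with
  | unary B s => exact hu ▸ h.1
  | role S s s' => exact hu.elim (fun e => e ▸ h.1) (fun e => e ▸ h.2.1)
  | eq s s' => exact hu.elim (fun e => e ▸ h.1) (fun e => e ▸ h.2.1)

theorem DM.liftHolds {K : KB C R Ind} {f : Fact C R (DTerm C R Ind)} (h : DM K f) :
    LiftHolds K f := by
  induction h with
  | abU h => exact ⟨⟨_, .ind _⟩, by rintro _ ⟨⟩; exact .abU h⟩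
  | abR h =>
    exact ⟨⟨_, .ind _⟩, ⟨_, .ind _⟩, by rintro _ ⟨⟩; exact ⟨_, .ind _, .abR h⟩,
      by rintro _ ⟨⟩; exact ⟨_, .abR h⟩⟩
  | nom h => exact ⟨⟨_, .ind _⟩, by rintro _ ⟨⟩; exact .nom h⟩
  | sub h _ ih => exact ⟨ih.1, fun w hw => .sub h (ih.2 w hw)⟩
  | subNom h _ ih =>
    exact ⟨ih.1, ⟨_, .ind _⟩, .inr (by rintro w _ hw ⟨⟩; exact .subNom h (ih.2 w hw))⟩
  | conj h _ _ ih1 ih2 => exact ⟨ih1.1, fun w hw => .conj h (ih1.2 w hw) (ih2.2 w hw)⟩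
  | exSub h _ _ ih1 ih2 =>
    refine ⟨ih1.1, fun w hw => ?_⟩
    obtain ⟨w', hw', hS⟩ := ih1.2.2.1 w hw
    exact .exSub h hS (ih2.2 w' hw')
  | subEx1 h _ ih =>
    obtain ⟨⟨w₀, hw₀⟩, ih⟩ := ih
    refine ⟨⟨w₀, hw₀⟩, ⟨_, .aux h (ih w₀ hw₀)⟩,
      fun w hw => ⟨_, .aux h (ih w hw), .subEx1 h (ih w hw)⟩, ?_⟩
    rintro _ (_ | ⟨h₁, h₂⟩)
    exact ⟨_, .subEx1 h₁ h₂⟩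
  | subEx2 h _ ih =>
    obtain ⟨⟨w₀, hw₀⟩, ih⟩ := ih
    refine ⟨⟨_, .aux h (ih w₀ hw₀)⟩, ?_⟩
    rintro _ (_ | ⟨h₁, h₂⟩)
    exact .subEx2 h₁ h₂
  | roleSub h _ ih =>
    obtain ⟨hu, hv, hl, hr⟩ := ih
    refine ⟨hu, hv, fun w hw => ?_, fun w' hw' => ?_⟩
    · obtain ⟨w', hw', hS⟩ := hl w hw
      exact ⟨w', hw', .roleSub h hS⟩
    · obtain ⟨w, hS⟩ := hr w' hw'
      exact ⟨w, .roleSub h hS⟩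
  | range h _ ih =>
    refine ⟨ih.2.1, fun w' hw' => ?_⟩
    obtain ⟨w, hS⟩ := ih.2.2.2 w' hw'
    exact .range h hS
  | topU h _ ih => exact ⟨ih.1, fun w hw => .topU h (ih.2 w hw)⟩
  | topR1 h _ ih =>
    refine ⟨ih.1, fun w hw => ?_⟩
    obtain ⟨w', _, hS⟩ := ih.2.2.1 w hw
    exact .topR1 h hS
  | topR2 h _ ih =>
    refine ⟨ih.2.1, fun w' hw' => ?_⟩
    obtain ⟨w, hS⟩ := ih.2.2.2 w' hw'
    exact .topR2 h hS
  | refl _ ho ih => exact ⟨ih.exists_lifts ho, ih.exists_lifts ho, .inl rfl⟩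
  | symm _ ih =>
    exact ⟨ih.2.1, ih.1, ih.2.2.imp Eq.symm fun h w w' hw hw' => .symm (h w' w hw' hw)⟩
  | trans _ _ ih1 ih2 =>
    obtain ⟨hu, ⟨x, hx⟩, rfl | h1⟩ := ih1
    · exact ih2
    · obtain ⟨_, ht, rfl | h2⟩ := ih2
      · exact ⟨hu, ht, .inr h1⟩
      · exact ⟨hu, ht, .inr fun w w' hw hw' => .trans (h1 w x hw hx) (h2 x w' hx hw')⟩
  | repU _ _ ih1 ih2 =>
    obtain ⟨⟨x, hx⟩, hv, rfl | h⟩ := ih2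
    · exact ih1
    · exact ⟨hv, fun w hw => .repU (ih1.2 x hx) (h x w hx hw)⟩
  | repR1 _ _ ih1 ih2 =>
    obtain ⟨⟨x, hx⟩, hu', rfl | h⟩ := ih2
    · exact ih1
    · obtain ⟨_, hv, hl, hr⟩ := ih1
      obtain ⟨w', hw', hS⟩ := hl x hx
      exact ⟨hu', hv, fun w hw => ⟨w', hw', .repR1 hS (h x w hx hw)⟩, hr⟩
  | repR2 _ _ ih1 ih2 =>
    obtain ⟨⟨x, hx⟩, ⟨y, hy⟩, rfl | h⟩ := ih2
    · exact ih1
    · obtain ⟨hu, _, hl, hr⟩ := ih1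
      refine ⟨hu, ⟨y, hy⟩, fun w hw => ?_, fun w' hw' => ?_⟩
      · obtain ⟨z, hz, hS⟩ := hl w hw
        exact ⟨y, hy, .repR2 hS (h z y hz hy)⟩
      · obtain ⟨w, hS⟩ := hr x hx
        exact ⟨w, .repR2 hS (h x w' hx hw')⟩

/-- Ξ(K) ⊨ ∃y.⊥(y) iff dat(K) ⊨ ∃y.⊥(y): the satisfiability of K can be
    decided on the datalog program dat(K). -/
theorem sat_via_datalog (K : KB C R Ind) :
    (∃ w : XTerm C R Ind, XI K (.unary .bot w))
  ↔ (∃ u : DTerm C R Ind, DM K (.unary .bot u)) := by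
  constructor
  · rintro ⟨w, h⟩
    exact ⟨δ w, h.deltaHolds⟩
  · rintro ⟨u, h⟩
    obtain ⟨⟨w, hw⟩, hB⟩ := h.liftHolds
    exact ⟨w, hB w hw⟩

end ELHO
end

section
/- Let I be the minimal Herbrand model of Ξ(K). For every term w2, every role R, and every A among the atomic concepts and ⊤: if f_{R,A}(w2)∈N_I(I), then both R(w2,f_{R,A}(w2))∈I and A(f_{R,A}(w2))∈I. -/
namespace ELHO

variable {C R V Ind : Type}

/-- A term is supported if, whenever it is functional, the facts introduced together with it
by its existential axiom hold in the minimal Herbrand model. -/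
def Supported (K : KB C R Ind) : XTerm C R Ind → Prop
  | .ind _ => True
  | .fn S A w => XI K (.role S w (.fn S A w)) ∧ XI K (.unary (ctU A) (.fn S A w))

/-- All terms of a non-equality fact are supported, and an equality fact relates two supported
or two unsupported terms. -/
def RespectsSupport (K : KB C R Ind) : Fact C R (XTerm C R Ind) → Prop
  | .unary _ t => Supported K t
  | .role _ s t => Supported K s ∧ Supported K t
  | .eq s t => Supported K s ↔ Supported K t

theorem supported_fn_of_eq {K : KB C R Ind} {S : R} {A : CT C} {w w' : XTerm C R Ind}
    (h : XI K (.eq w w')) (hw : Supported K (.fn S A w)) : Supported K (.fn S A w') :=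
  ⟨.repR2 (.repR1 hw.1 h) (.repF h), .repU hw.2 (.repF h)⟩

theorem XI.respectsSupport {K : KB C R Ind} {f : Fact C R (XTerm C R Ind)} (h : XI K f) :
    RespectsSupport K f := by
  induction h with
  | abU _ => trivial
  | abR _ => exact ⟨trivial, trivial⟩
  | nom _ => trivial
  | sub _ _ ih => exact ih
  | subNom _ _ ih => exact ⟨fun _ => trivial, fun _ => ih⟩
  | conj _ _ _ ih _ => exact ih
  | exSub _ _ _ ih _ => exact ih.1
  | subEx1 hax hw ih => exact ⟨ih, .subEx1 hax hw, .subEx2 hax hw⟩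
  | subEx2 hax hw _ => exact ⟨.subEx1 hax hw, .subEx2 hax hw⟩
  | roleSub _ _ ih => exact ih
  | range _ _ ih => exact ih.2
  | topU _ _ ih => exact ih
  | topR1 _ _ ih => exact ih.1
  | topR2 _ _ ih => exact ih.2
  | refl _ _ _ => exact Iff.rfl
  | symm _ ih => exact Iff.symm ih
  | trans _ _ ih₁ ih₂ => exact Iff.trans ih₁ ih₂
  | repU _ _ ih ihe => exact Iff.mp ihe ih
  | repR1 _ _ ih ihe => exact ⟨Iff.mp ihe ih.1, ih.2⟩
  | repR2 _ _ ih ihe => exact ⟨ih.1, Iff.mp ihe ih.2⟩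
  | repF h _ => exact ⟨supported_fn_of_eq h, supported_fn_of_eq h.symm⟩

theorem supported_of_NI {K : KB C R Ind} {t : XTerm C R Ind} (h : NI (XI K) t) :
    Supported K t := by
  obtain ⟨f, hf, ht⟩ := h
  have hs := hf.respectsSupport
  cases f with
  | unary B s => obtain rfl : s = t := ht; exact hs
  | role S s s' =>
    rcases ht with rfl | rfl
    · exact hs.1
    · exact hs.2
  | eq s s' => exact ht.elim

/-- If a functional term f_{R,A}(w2) occurs in a non-≈ fact of the minimal
    Herbrand model I of Ξ(K), then R(w2, f_{R,A}(w2)) ∈ I and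
    A(f_{R,A}(w2)) ∈ I. -/
theorem aux_inds (K : KB C R Ind) (w2 : XTerm C R Ind) (S : R) (A : CT C)
    (h : NI (XI K) (.fn S A w2)) :
    XI K (.role S w2 (.fn S A w2)) ∧ XI K (.unary (ctU A) (.fn S A w2)) :=
  supported_of_NI h

end ELHO
end

section
/- Let D be the minimal Herbrand model of dat(K). For all terms u1 and u2 of the Herbrand universe of dat(K): if u1≈u2∈D and u2∈aux(D), then u1=u2. (That is, a term not ≈-equal to any named individual in D is ≈-equal only to itself.) -/
namespace ELHO

variable {C R V Ind : Type}

/-- Two terms that are ≈-equal in the minimal Herbrand model of dat(K) are identical, or each is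
    ≈-equal to some named individual. -/
theorem DM.eq_or_named {K : KB C R Ind} {u v : DTerm C R Ind} (h : DM K (.eq u v)) :
    u = v ∨ (∃ a, DM K (.eq u (.ind a))) ∧ ∃ a, DM K (.eq v (.ind a)) := by
  generalize hf : Fact.eq u v = f at h
  induction h generalizing u v with
  | subNom hax hw =>
    cases hf
    exact .inr ⟨⟨_, .subNom hax hw⟩, _, .refl (.subNom hax hw) (.inr rfl)⟩
  | refl => cases hf; exact .inl rfl
  | symm _ ih =>
    cases hf
    exact (ih rfl).imp Eq.symm And.symm
  | trans _ _ ih₁ ih₂ =>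
    cases hf
    rcases ih₁ rfl with rfl | ⟨hu, hw⟩
    · exact ih₂ rfl
    · rcases ih₂ rfl with rfl | ⟨-, hv⟩
      · exact .inr ⟨hu, hw⟩
      · exact .inr ⟨hu, hv⟩
  | _ => cases hf

/-- In the minimal Herbrand model D of dat(K), a term of aux(D) is ≈-equal
    only to itself. -/
theorem eq_aux_trivial (K : KB C R Ind) (u1 u2 : DTerm C R Ind)
    (h1 : DM K (.eq u1 u2)) (h2 : auxT (DM K) DTerm.ind u2) :
    u1 = u2 := by
  rcases h1.eq_or_named with h | ⟨-, a, ha⟩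
  · exact h
  · exact absurd ha (h2.2 a)

end ELHO
end

section
/- Let I be the minimal Herbrand model of Ξ(K). For all terms w1, w2, all roles T, T', and all A, A' among the atomic concepts and ⊤: if f_{T',A'}(w2)∈aux(I) and f_{T,A}(w1)≈f_{T',A'}(w2)∈I, then T=T', A=A', and w1≈w2∈I. -/
namespace ELHO

variable {C R V Ind : Type}

/-- `t` is an individual, or its immediate subterm is ≈-equal to itself in the model. -/
def ArgRefl (K : KB C R Ind) : XTerm C R Ind → Prop
  | .ind _ => True
  | .fn _ _ w => XI K (.eq w w)

/-- `s` and `t` are both ≈-equal to a common individual, or they are functional terms with the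
same head symbol and ≈-equal arguments. -/
def EqCause (K : KB C R Ind) (s t : XTerm C R Ind) : Prop :=
  (∃ a, XI K (.eq s (.ind a)) ∧ XI K (.eq t (.ind a))) ∨
    ∃ S A u v, s = .fn S A u ∧ t = .fn S A v ∧ XI K (.eq u v)

/-- The invariant of facts in the minimal model of `Ξ(K)` behind the injectivity of the function
symbols on 'true' auxiliary terms. -/
def FactInv (K : KB C R Ind) : Fact C R (XTerm C R Ind) → Prop
  | .unary _ t => ArgRefl K t
  | .role _ s t => ArgRefl K s ∧ ArgRefl K t
  | .eq s t => ArgRefl K s ∧ ArgRefl K t ∧ EqCause K s t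

theorem FactInv.argRefl {K : KB C R Ind} {f : Fact C R (XTerm C R Ind)} {t : XTerm C R Ind}
    (h : FactInv K f) (ht : occursF t f) : ArgRefl K t := by
  cases f with
  | unary => exact ht ▸ h
  | role => exact ht.elim (fun e => e ▸ h.1) (fun e => e ▸ h.2)
  | eq => exact ht.elim (fun e => e ▸ h.1) (fun e => e ▸ h.2.1)

theorem EqCause.of_eq_ind {K : KB C R Ind} {s : XTerm C R Ind} {a : Ind}
    (h : XI K (.eq s (.ind a))) : EqCause K s (.ind a) :=
  .inl ⟨a, h, h.symm.trans h⟩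

theorem EqCause.symm {K : KB C R Ind} {s t : XTerm C R Ind} :
    EqCause K s t → EqCause K t s
  | .inl ⟨a, hs, ht⟩ => .inl ⟨a, ht, hs⟩
  | .inr ⟨S, A, u, v, hs, ht, h⟩ => .inr ⟨S, A, v, u, ht, hs, h.symm⟩

theorem EqCause.trans {K : KB C R Ind} {s t r : XTerm C R Ind}
    (hst : XI K (.eq s t)) (htr : XI K (.eq t r))
    (h₁ : EqCause K s t) (h₂ : EqCause K t r) : EqCause K s r := by
  rcases h₁ with ⟨a, hs, ht⟩ | ⟨S, A, u, v, rfl, rfl, huv⟩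
  · exact .inl ⟨a, hs, htr.symm.trans ht⟩
  · rcases h₂ with ⟨a, ht, hr⟩ | ⟨S', A', v', x, e, rfl, hvx⟩
    · exact .inl ⟨a, hst.trans ht, hr⟩
    · cases e
      exact .inr ⟨_, _, _, _, rfl, rfl, huv.trans hvx⟩

theorem XI.factInv {K : KB C R Ind} {f : Fact C R (XTerm C R Ind)} (h : XI K f) :
    FactInv K f := by
  induction h with
  | abU | nom => trivial
  | abR => exact ⟨trivial, trivial⟩
  | sub _ _ ih => exact ih
  | subNom hK h ih => exact ⟨ih, trivial, .of_eq_ind (.subNom hK h)⟩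
  | conj _ _ _ ih => exact ih
  | exSub _ _ _ ih => exact ih.1
  | subEx1 _ h ih => exact ⟨ih, .refl h rfl⟩
  | subEx2 _ h => exact .refl h rfl
  | roleSub _ _ ih => exact ih
  | range _ _ ih => exact ih.2
  | topU _ _ ih => exact ih
  | topR1 _ _ ih => exact ih.1
  | topR2 _ _ ih => exact ih.2
  | @refl w f h hw ih =>
    refine ⟨ih.argRefl hw, ih.argRefl hw, ?_⟩
    cases w with
    | ind a => exact .of_eq_ind (.refl h hw)
    | fn S A w => exact .inr ⟨S, A, w, w, rfl, rfl, ih.argRefl hw⟩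
  | symm _ ih => exact ⟨ih.2.1, ih.1, ih.2.2.symm⟩
  | trans h₁ h₂ ih₁ ih₂ => exact ⟨ih₁.1, ih₂.2.1, .trans h₁ h₂ ih₁.2.2 ih₂.2.2⟩
  | repU _ _ _ ih => exact ih.2.1
  | repR1 _ _ ih₁ ih₂ => exact ⟨ih₂.2.1, ih₁.2⟩
  | repR2 _ _ ih₁ ih₂ => exact ⟨ih₁.1, ih₂.2.1⟩
  | repF h => exact ⟨h.trans h.symm, h.symm.trans h, .inr ⟨_, _, _, _, rfl, rfl, h⟩⟩

/-- Property A1: equalities between functional terms with a 'true' auxiliary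
    right-hand side force the same function symbol and equal arguments. -/
theorem fn_eq_same_symbol (K : KB C R Ind) (w1 w2 : XTerm C R Ind)
    (T T' : R) (A A' : CT C)
    (h1 : auxT (XI K) XTerm.ind (.fn T' A' w2))
    (h2 : XI K (.eq (.fn T A w1) (.fn T' A' w2))) :
    T = T' ∧ A = A' ∧ XI K (.eq w1 w2) := by
  rcases h2.factInv.2.2 with ⟨a, _, ha⟩ | ⟨S, B, u, v, e₁, e₂, huv⟩
  · exact absurd ha (h1.2 a)
  · cases e₁
    cases e₂
    exact ⟨rfl, rfl, huv⟩

end ELHO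
end

section
/- Let I be the minimal Herbrand model of Ξ(K). For all terms w' and w, every role R, every role T, and every A among the atomic concepts and ⊤: if f_{T,A}(w)∈aux(I) and R(w',f_{T,A}(w))∈I, then there exists a term w'' such that T(w'',f_{T,A}(w''))∈I, w'≈w''∈I, and f_{T,A}(w)≈f_{T,A}(w'')∈I. -/
namespace ELHO

variable {C R V Ind : Type}

/-- Equal terms are either equal to a named individual or share their outermost symbol. -/
theorem XI.named_or_δ_eq {K : KB C R Ind} {s t : XTerm C R Ind} (h : XI K (.eq s t)) :
    (∃ a, XI K (.eq s (.ind a))) ∨ δ s = δ t := by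
  generalize hf : Fact.eq s t = f at h
  induction h generalizing s t <;> cases hf
  case subNom a _ hax hu _ => exact .inl ⟨a, .subNom hax hu⟩
  case refl => exact .inr rfl
  case symm h ih =>
    obtain ⟨a, ha⟩ | e := ih rfl
    · exact .inl ⟨a, .trans (.symm h) ha⟩
    · exact .inr e.symm
  case trans h _ ih₁ ih₂ =>
    obtain ha | e := ih₁ rfl
    · exact .inl ha
    obtain ⟨a, ha⟩ | e' := ih₂ rfl
    · exact .inl ⟨a, .trans h ha⟩
    · exact .inr (e.trans e')
  case repF => exact .inr rfl

/-- The target of a role edge is equal to a named individual, or the edge is, up to equality,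
parallel to a tree edge. -/
theorem XI.named_or_tree_edge {K : KB C R Ind} {S : R} {s t : XTerm C R Ind}
    (h : XI K (.role S s t)) :
    (∃ a, XI K (.eq t (.ind a))) ∨
      ∃ T A w, XI K (.role T w (.fn T A w)) ∧ XI K (.eq s w) ∧ XI K (.eq t (.fn T A w)) := by
  generalize hf : Fact.role S s t = f at h
  induction h generalizing S s t <;> cases hf
  case abR b hab => exact .inl ⟨b, .refl (.abR hab) (.inr rfl)⟩
  case subEx1 hax hu _ =>
    have h := XI.subEx1 hax hu
    exact .inr ⟨_, _, _, h, .refl h (.inl rfl), .refl h (.inr rfl)⟩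
  case roleSub ih => exact ih rfl
  case repR1 he ih _ =>
    obtain ha | ⟨T, A, w, hr, hs, ht⟩ := ih rfl
    · exact .inl ha
    · exact .inr ⟨T, A, w, hr, .trans (.symm he) hs, ht⟩
  case repR2 he ih _ =>
    obtain ⟨a, ha⟩ | ⟨T, A, w, hr, hs, ht⟩ := ih rfl
    · exact .inl ⟨a, .trans (.symm he) ha⟩
    · exact .inr ⟨T, A, w, hr, hs, .trans (.symm he) ht⟩

/-- Property A2: every role edge into a 'true' auxiliary functional term comes,
    up to ≈, from a tree edge T(w'', f_{T,A}(w'')). -/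
theorem edge_into_aux (K : KB C R Ind) (w' w : XTerm C R Ind)
    (S T : R) (A : CT C)
    (h1 : auxT (XI K) XTerm.ind (.fn T A w))
    (h2 : XI K (.role S w' (.fn T A w))) :
    ∃ w'' : XTerm C R Ind,
      XI K (.role T w'' (.fn T A w'')) ∧ XI K (.eq w' w'') ∧
      XI K (.eq (.fn T A w) (.fn T A w'')) := by
  obtain ⟨a, ha⟩ | ⟨T', A', w'', hr, hs, ht⟩ := h2.named_or_tree_edge
  · exact absurd ha (h1.2 a)
  obtain ⟨a, ha⟩ | e := ht.named_or_δ_eq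
  · exact absurd ha (h1.2 a)
  cases e
  exact ⟨w'', hr, hs, ht⟩

end ELHO
end
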